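/- arXiv:1511.01932 — 7 statements merged into one kernel-verified Lean document; each statement's English description precedes it below -/
import Mathlib

section
/- Let b > 1 and κ ∈ (−1/b, 0) be real numbers. Then for every t > 0 one has f⁻(t) = (1/κ)·tanh(t) + tanh(b·t) < 0 and f⁺(t) = κ·tanh(t) + tanh(b·t) > 0; in particular neither f⁺ nor f⁻ vanishes on (0, +∞). -/
theorem Real.hasDerivAt_tanh (x : ℝ) : HasDerivAt Real.tanh (1 / Real.cosh x ^ 2) x := by
  have h := (Real.hasDerivAt_sinh x).fun_div (Real.hasDerivAt_cosh x) (Real.cosh_pos x).ne'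
  have hfun : Real.tanh = fun y => Real.sinh y / Real.cosh y :=
    funext Real.tanh_eq_sinh_div_cosh
  have hnum : Real.cosh x * Real.cosh x - Real.sinh x * Real.sinh x = 1 := by
    linarith [Real.cosh_sq x]
  rwa [hnum, ← hfun] at h

theorem Real.tanh_strictMono : StrictMono Real.tanh :=
  strictMono_of_deriv_pos fun x => by
    rw [(Real.hasDerivAt_tanh x).deriv]
    have := Real.cosh_pos x
    positivity

theorem Real.tanh_mul_le_mul_tanh {b t : ℝ} (hb : 1 ≤ b) (ht : 0 ≤ t) :
    Real.tanh (b * t) ≤ b * Real.tanh t := by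
  have hd (x : ℝ) : HasDerivAt (fun x => b * Real.tanh x - Real.tanh (b * x))
      (b * (1 / Real.cosh x ^ 2) - 1 / Real.cosh (b * x) ^ 2 * (b * 1)) x :=
    ((Real.hasDerivAt_tanh x).const_mul b).sub
      ((Real.hasDerivAt_tanh (b * x)).comp x ((hasDerivAt_id x).const_mul b))
  have hmono : MonotoneOn (fun x => b * Real.tanh x - Real.tanh (b * x)) (Set.Ici 0) := by
    refine monotoneOn_of_deriv_nonneg (convex_Ici 0)
      (fun x _ => (hd x).continuousAt.continuousWithinAt)
      (fun x _ => (hd x).differentiableAt.differentiableWithinAt) fun x hx => ?_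
    rw [interior_Ici, Set.mem_Ioi] at hx
    have hcosh : Real.cosh x ≤ Real.cosh (b * x) := by
      rw [Real.cosh_le_cosh, abs_of_pos hx, abs_of_pos (by positivity)]
      nlinarith
    have hpos := Real.cosh_pos x
    have hle : 1 / Real.cosh (b * x) ^ 2 ≤ 1 / Real.cosh x ^ 2 := by gcongr
    rw [(hd x).deriv]
    nlinarith
  simpa using hmono Set.self_mem_Ici ht ht

/-- For b > 1 and κ ∈ (−1/b, 0), for every t > 0 one has
f⁻(t) = (1/κ)·tanh t + tanh(b·t) < 0 and f⁺(t) = κ·tanh t + tanh(b·t) > 0;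
in particular neither f⁺ nor f⁻ vanishes on (0,∞). -/
theorem stmt_1 (b κ : ℝ) (hb : 1 < b) (hκ1 : -(1/b) < κ) (hκ2 : κ < 0) :
    ∀ t : ℝ, 0 < t →
      ((1/κ) * Real.tanh t + Real.tanh (b * t) < 0 ∧
       0 < κ * Real.tanh t + Real.tanh (b * t)) := by
  intro t ht
  have hb0 : 0 < b := by linarith
  have htanh : 0 < Real.tanh t := by simpa using Real.tanh_strictMono ht
  constructor
  · have hκb : 1 / κ < -b := by
      rw [div_lt_iff_of_neg hκ2]
      have := mul_lt_mul_of_pos_left hκ1 hb0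
      rw [mul_neg, mul_one_div_cancel hb0.ne'] at this
      linarith
    nlinarith [Real.tanh_mul_le_mul_tanh hb.le ht.le]
  · have hκ : -1 < κ := by
      have : 1 / b < 1 := (div_lt_one hb0).2 hb
      linarith
    have : Real.tanh t < Real.tanh (b * t) := Real.tanh_strictMono (by nlinarith)
    nlinarith
end

section
/- Let b > 1 and let κ ∈ (−b, −1) be real numbers. Then there exists a unique t > 0 such that f⁺(t) = κ·tanh(t) + tanh(b·t) = 0; moreover f⁻(t) = (1/κ)·tanh(t) + tanh(b·t) > 0 for all t > 0. -/
namespace Real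

theorem mul_sinh_lt_sinh_mul {b x : ℝ} (hb : 1 < b) (hx : 0 < x) :
    b * sinh x < sinh (b * x) := by
  have hd (y : ℝ) : HasDerivAt (fun y => sinh (b * y) - b * sinh y)
      (cosh (b * y) * (b * 1) - b * cosh y) y :=
    ((hasDerivAt_id y).const_mul b).sinh.sub ((hasDerivAt_sinh y).const_mul b)
  have hmono : StrictMonoOn (fun y => sinh (b * y) - b * sinh y) (Set.Ici 0) := by
    refine strictMonoOn_of_deriv_pos (convex_Ici 0)
      (fun y _ => (hd y).continuousAt.continuousWithinAt) fun y hy => ?_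
    rw [interior_Ici, Set.mem_Ioi] at hy
    have hby : y < b * y := by nlinarith
    have hcosh : cosh y < cosh (b * y) := by
      rw [cosh_lt_cosh, abs_of_pos hy, abs_of_pos (hy.trans hby)]
      exact hby
    rw [(hd y).deriv]
    nlinarith
  have h := hmono Set.self_mem_Ici hx.le hx
  simp only [mul_zero, sinh_zero, sub_zero] at h
  linarith

theorem hasDerivAt_tanh_one_div_cosh_sq (x : ℝ) :
    HasDerivAt tanh (1 / cosh x ^ 2) x := by
  have h := (hasDerivAt_sinh x).div (hasDerivAt_cosh x) (cosh_pos x).ne'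
  have he : tanh = sinh / cosh := funext tanh_eq_sinh_div_cosh
  rw [he]
  rwa [← sq, ← sq, cosh_sq_sub_sinh_sq] at h

theorem strictMono_tanh : StrictMono tanh :=
  strictMono_of_deriv_pos fun x => by
    rw [(hasDerivAt_tanh_one_div_cosh_sq x).deriv]
    have := cosh_pos x
    positivity

theorem tanh_pos_of_pos {x : ℝ} (hx : 0 < x) : 0 < tanh x := by
  simpa using strictMono_tanh hx

theorem hasDerivAt_tanh_const_mul (b x : ℝ) :
    HasDerivAt (fun y => tanh (b * y)) (1 / cosh (b * x) ^ 2 * b) x := by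
  have h := (hasDerivAt_tanh_one_div_cosh_sq (b * x)).comp x ((hasDerivAt_id x).const_mul b)
  simpa [Function.comp_def] using h

theorem strictAntiOn_tanh_mul_div_tanh {b : ℝ} (hb : 1 < b) :
    StrictAntiOn (fun t => tanh (b * t) / tanh t) (Set.Ioi 0) := by
  have hd {t : ℝ} (ht : 0 < t) :=
    (hasDerivAt_tanh_const_mul b t).fun_div (hasDerivAt_tanh_one_div_cosh_sq t)
      (tanh_pos_of_pos ht).ne'
  refine strictAntiOn_of_deriv_neg (convex_Ioi 0)
    (fun t ht => (hd ht).continuousAt.continuousWithinAt) fun t ht => ?_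
  rw [interior_Ioi, Set.mem_Ioi] at ht
  rw [(hd ht).deriv]
  refine div_neg_of_neg_of_pos ?_ (pow_pos (tanh_pos_of_pos ht) 2)
  have hsinh := mul_sinh_lt_sinh_mul hb (mul_pos two_pos ht)
  rw [mul_left_comm, sinh_two_mul, sinh_two_mul] at hsinh
  have hc := cosh_pos t
  have hcb := cosh_pos (b * t)
  have key : 1 / cosh (b * t) ^ 2 * b * tanh t - tanh (b * t) * (1 / cosh t ^ 2) =
      (b * (sinh t * cosh t) - sinh (b * t) * cosh (b * t)) /
        (cosh (b * t) ^ 2 * cosh t ^ 2) := by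
    rw [tanh_eq_sinh_div_cosh, tanh_eq_sinh_div_cosh]
    field_simp
  rw [key]
  exact div_neg_of_neg_of_pos (by linarith) (by positivity)

end Real

open Real in
theorem exists_pos_lt_mul_tanh_add_tanh_pos {b κ T : ℝ} (hκ : -b < κ) (hT : 0 < T) :
    ∃ ε, 0 < ε ∧ ε < T ∧ 0 < κ * tanh ε + tanh (b * ε) := by
  have hd := ((hasDerivAt_tanh_one_div_cosh_sq 0).const_mul κ).fun_add
    (hasDerivAt_tanh_const_mul b 0)
  have hslope := hd.tendsto_slope_zero_right.eventually
    (lt_mem_nhds (show 0 < _ by simp; linarith))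
  obtain ⟨ε, hε, hlt, hpos⟩ := (hslope.and (Ioo_mem_nhdsGT hT)).exists
  refine ⟨ε, hlt, hpos, ?_⟩
  simp only [zero_add, mul_zero, tanh_zero, sub_zero, smul_eq_mul] at hε
  exact pos_of_mul_pos_right hε (inv_pos.2 hlt).le

/-- For b > 1 and κ ∈ (−b, −1), there is a unique t > 0 with
f⁺(t) = κ·tanh t + tanh(b·t) = 0, and f⁻(t) = (1/κ)·tanh t + tanh(b·t) > 0
for all t > 0. -/
theorem stmt_2 (b κ : ℝ) (hb : 1 < b) (hκ1 : -b < κ) (hκ2 : κ < -1) :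
    (∃! t : ℝ, 0 < t ∧ κ * Real.tanh t + Real.tanh (b * t) = 0) ∧
    (∀ t : ℝ, 0 < t → 0 < (1/κ) * Real.tanh t + Real.tanh (b * t)) := by
  have hκ : κ < 0 := by linarith
  refine ⟨?_, fun t ht => ?_⟩
  · apply existsUnique_of_exists_of_unique
    · have hmem : -κ⁻¹ ∈ Set.Ioo (0 : ℝ) 1 := by
        rw [← inv_neg]
        exact ⟨inv_pos.2 (by linarith), inv_lt_one_of_one_lt₀ (by linarith)⟩
      have hT := Real.artanh_pos hmem
      obtain ⟨ε, hε, hlt, hpos⟩ := exists_pos_lt_mul_tanh_add_tanh_pos hκ1 hT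
      have hcont : Continuous fun t => κ * Real.tanh t + Real.tanh (b * t) :=
        continuous_iff_continuousAt.2 fun t =>
          (((Real.hasDerivAt_tanh_one_div_cosh_sq t).const_mul κ).fun_add
            (Real.hasDerivAt_tanh_const_mul b t)).continuousAt
      have hneg : κ * Real.tanh (Real.artanh (-κ⁻¹)) +
          Real.tanh (b * Real.artanh (-κ⁻¹)) ≤ 0 := by
        rw [Real.tanh_artanh ⟨by linarith [hmem.1], hmem.2⟩, mul_neg, mul_inv_cancel₀ hκ.ne]
        linarith [Real.tanh_lt_one (b * Real.artanh (-κ⁻¹))]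
      obtain ⟨t, ht, h0⟩ := intermediate_value_Icc' hlt.le hcont.continuousOn ⟨hneg, hpos.le⟩
      exact ⟨t, hε.trans_le ht.1, h0⟩
    · have hratio {t : ℝ} (ht : 0 < t ∧ κ * Real.tanh t + Real.tanh (b * t) = 0) :
          Real.tanh (b * t) / Real.tanh t = -κ := by
        rw [div_eq_iff (Real.tanh_pos_of_pos ht.1).ne']
        linarith [ht.2]
      intro s t hs ht
      exact (Real.strictAntiOn_tanh_mul_div_tanh hb).injOn hs.1 ht.1
        ((hratio hs).trans (hratio ht).symm)
  · have hpos := Real.tanh_pos_of_pos ht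
    have hlt : Real.tanh t < Real.tanh (b * t) := Real.strictMono_tanh (by nlinarith)
    have hinv : -1 < 1 / κ := by
      rw [lt_div_iff_of_neg hκ]
      linarith
    nlinarith
end

section
/- The function h defined by h(t) = (sinh(t) − t)/(cosh(t) − 1) is strictly increasing on (0, +∞). -/
theorem Real.sinh_lt_mul_cosh {u : ℝ} (hu : 0 < u) : Real.sinh u < u * Real.cosh u := by
  have hd (x : ℝ) : HasDerivAt (fun x => x * Real.cosh x - Real.sinh x) (x * Real.sinh x) x := by
    refine (((hasDerivAt_id' x).mul (Real.hasDerivAt_cosh x)).sub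
      (Real.hasDerivAt_sinh x)).congr_deriv ?_
    ring
  have hmono : StrictMonoOn (fun x => x * Real.cosh x - Real.sinh x) (Set.Ici 0) := by
    refine strictMonoOn_of_deriv_pos (convex_Ici 0)
      (fun x _ => (hd x).continuousAt.continuousWithinAt) fun x hx => ?_
    rw [interior_Ici, Set.mem_Ioi] at hx
    rw [(hd x).deriv]
    exact mul_pos hx (Real.sinh_pos_iff.2 hx)
  simpa using hmono Set.self_mem_Ici hu.le hu

theorem Real.two_mul_cosh_sub_one_lt_mul_sinh {t : ℝ} (ht : 0 < t) :
    2 * (Real.cosh t - 1) < t * Real.sinh t := by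
  obtain ⟨u, rfl⟩ : ∃ u, t = 2 * u := ⟨t / 2, by ring⟩
  have hu : 0 < u := by linarith
  rw [Real.cosh_two_mul, Real.sinh_two_mul, Real.cosh_sq]
  linarith [mul_lt_mul_of_pos_left (Real.sinh_lt_mul_cosh hu) (Real.sinh_pos_iff.2 hu)]

/-- The function h(t) = (sinh t − t)/(cosh t − 1) is strictly increasing on (0, +∞). -/
theorem stmt_6 :
    StrictMonoOn (fun t : ℝ => (Real.sinh t - t) / (Real.cosh t - 1)) (Set.Ioi 0) := by
  have hpos {t : ℝ} (ht : 0 < t) : 0 < Real.cosh t - 1 :=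
    sub_pos.2 (Real.one_lt_cosh.2 ht.ne')
  have hd {t : ℝ} (ht : 0 < t) :=
    ((Real.hasDerivAt_sinh t).sub (hasDerivAt_id' t)).div
      ((Real.hasDerivAt_cosh t).sub_const 1) (hpos ht).ne'
  refine strictMonoOn_of_deriv_pos (convex_Ioi 0)
    (fun t ht => (hd ht).continuousAt.continuousWithinAt) fun t ht => ?_
  rw [interior_Ioi, Set.mem_Ioi] at ht
  refine (div_pos ?_ (pow_pos (hpos ht) 2)).trans_eq (hd ht).deriv.symm
  simp only [Pi.sub_apply]
  linarith [Real.cosh_sq t, Real.two_mul_cosh_sub_one_lt_mul_sinh ht]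
end

section
/- Let 0 < φ < π, η > 0, and let ε_m < 0 < ε_d be real numbers whose contrast κ = ε_m/ε_d satisfies κ ∈ (−(2π−φ)/φ, −1). Let Φ be the skew-symmetric corner profile and ε the piecewise permittivity. Then ∫_{−π}^{π} ε(θ)^{−1}·Φ(θ)² dθ > 0. -/
/-- The normalised profile `u ↦ sinh (η (t - u)) / sinh (η t)` at depth `u` is monotone in `t`. -/
lemma sinh_mul_sub_div_le {η a b u : ℝ} (hη : 0 < η) (ha : 0 < a) (hab : a ≤ b) (hu : 0 ≤ u) :
    Real.sinh (η * (a - u)) / Real.sinh (η * a) ≤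
      Real.sinh (η * (b - u)) / Real.sinh (η * b) := by
  have hSa : 0 < Real.sinh (η * a) := Real.sinh_pos_iff.2 (mul_pos hη ha)
  have hSb : 0 < Real.sinh (η * b) := Real.sinh_pos_iff.2 (mul_pos hη (ha.trans_le hab))
  rw [div_le_div_iff₀ hSa hSb]
  have h1 : 0 ≤ Real.sinh (η * u) := Real.sinh_nonneg_iff.2 (by positivity)
  have h2 : 0 ≤ Real.sinh (η * b - η * a) :=
    Real.sinh_nonneg_iff.2 (by nlinarith)
  have h3 := mul_nonneg h1 h2
  rw [Real.sinh_sub] at h3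
  rw [mul_sub, mul_sub, Real.sinh_sub, Real.sinh_sub]
  linarith

/-- The mean square `∫₀ᵗ (sinh (η s) / sinh (η t))² ds` is monotone in `t`. -/
lemma integral_sinh_div_sq_le {η a b : ℝ} (hη : 0 < η) (ha : 0 < a) (hab : a ≤ b) :
    ∫ s in (0 : ℝ)..a, (Real.sinh (η * s) / Real.sinh (η * a)) ^ 2 ≤
      ∫ s in (0 : ℝ)..b, (Real.sinh (η * s) / Real.sinh (η * b)) ^ 2 := by
  have key (t : ℝ) : ∫ s in (0 : ℝ)..t, (Real.sinh (η * s) / Real.sinh (η * t)) ^ 2 =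
      ∫ s in (0 : ℝ)..t, (Real.sinh (η * (t - s)) / Real.sinh (η * t)) ^ 2 := by
    rw [intervalIntegral.integral_comp_sub_left
      (fun s => (Real.sinh (η * s) / Real.sinh (η * t)) ^ 2) t]
    simp
  have hint (t x y : ℝ) : IntervalIntegrable
      (fun s => (Real.sinh (η * (t - s)) / Real.sinh (η * t)) ^ 2) MeasureTheory.volume x y :=
    Continuous.intervalIntegrable (by fun_prop) _ _
  rw [key, key, ← intervalIntegral.integral_add_adjacent_intervals (hint b 0 a) (hint b a b)]
  have h1 : ∫ s in (0 : ℝ)..a, (Real.sinh (η * (a - s)) / Real.sinh (η * a)) ^ 2 ≤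
      ∫ s in (0 : ℝ)..a, (Real.sinh (η * (b - s)) / Real.sinh (η * b)) ^ 2 := by
    refine intervalIntegral.integral_mono_on ha.le (hint a 0 a) (hint b 0 a) fun s hs => ?_
    have h0 : 0 ≤ Real.sinh (η * (a - s)) / Real.sinh (η * a) :=
      div_nonneg (Real.sinh_nonneg_iff.2 (mul_nonneg hη.le (sub_nonneg.2 hs.2)))
        (Real.sinh_nonneg_iff.2 (by positivity))
    exact pow_le_pow_left₀ h0 (sinh_mul_sub_div_le hη ha hab hs.1) 2
  have h2 : 0 ≤ ∫ s in a..b, (Real.sinh (η * (b - s)) / Real.sinh (η * b)) ^ 2 :=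
    intervalIntegral.integral_nonneg hab fun s _ => by positivity
  linarith

/-- A function agreeing with a continuous one on an open interval has the same integral there. -/
lemma intervalIntegrable_and_integral_eq_of_eqOn_Ioo {f g : ℝ → ℝ} {a b : ℝ} (hab : a ≤ b)
    (hg : Continuous g) (h : Set.EqOn f g (Set.Ioo a b)) :
    IntervalIntegrable f MeasureTheory.volume a b ∧ ∫ x in a..b, f x = ∫ x in a..b, g x := by
  constructor
  · rw [intervalIntegrable_iff_integrableOn_Ioo_of_le hab]
    exact ((intervalIntegrable_iff_integrableOn_Ioo_of_le hab).1
      (hg.intervalIntegrable a b)).congr_fun h.symm measurableSet_Ioo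
  · rw [intervalIntegral.integral_of_le hab, intervalIntegral.integral_of_le hab,
      MeasureTheory.integral_Ioc_eq_integral_Ioo, MeasureTheory.integral_Ioc_eq_integral_Ioo]
    exact MeasureTheory.setIntegral_congr_fun measurableSet_Ioo h

/-- For 0 < φ < π, η > 0, ε_m < 0 < ε_d with contrast κ = ε_m/ε_d ∈ (−(2π−φ)/φ, −1),
the skew-symmetric corner profile Φ and piecewise permittivity ε satisfy
∫_{−π}^{π} ε(θ)⁻¹ Φ(θ)² dθ > 0. -/
theorem stmt_10 (φ η εm εd : ℝ) (hφ0 : 0 < φ) (hφπ : φ < Real.pi) (hη : 0 < η)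
    (hεm : εm < 0) (hεd : 0 < εd)
    (hκ1 : -((2 * Real.pi - φ) / φ) < εm / εd) (hκ2 : εm / εd < -1)
    (Φ ε : ℝ → ℝ)
    (hΦ1 : ∀ θ, 0 ≤ θ → θ ≤ φ / 2 →
      Φ θ = Real.sinh (η * θ) / Real.sinh (η * (φ / 2)))
    (hΦ2 : ∀ θ, φ / 2 ≤ θ → θ ≤ Real.pi →
      Φ θ = Real.sinh (η * (Real.pi - θ)) / Real.sinh (η * (Real.pi - φ / 2)))
    (hΦ3 : ∀ θ, -Real.pi ≤ θ → θ ≤ 0 → Φ θ = -Φ (-θ))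
    (hε1 : ∀ θ, |θ| < φ / 2 → ε θ = εm)
    (hε2 : ∀ θ, φ / 2 < |θ| → |θ| ≤ Real.pi → ε θ = εd) :
    0 < ∫ θ in (-Real.pi)..Real.pi, (ε θ)⁻¹ * (Φ θ)^2 := by
  set a := φ / 2 with ha
  have ha0 : 0 < a := by positivity
  have hab : a ≤ Real.pi - a := by linarith
  have haπ : a < Real.pi := by linarith
  set A := ∫ s in (0 : ℝ)..a, (Real.sinh (η * s) / Real.sinh (η * a)) ^ 2 with hA
  set B := ∫ s in (0 : ℝ)..(Real.pi - a),
    (Real.sinh (η * s) / Real.sinh (η * (Real.pi - a))) ^ 2 with hB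
  have hAB : A ≤ B := integral_sinh_div_sq_le hη ha0 hab
  have hA0 : 0 < A := by
    refine intervalIntegral.intervalIntegral_pos_of_pos_on
      (Continuous.intervalIntegrable (by fun_prop) _ _) (fun s hs => ?_) ha0
    exact pow_pos (div_pos (Real.sinh_pos_iff.2 (mul_pos hη hs.1))
      (Real.sinh_pos_iff.2 (mul_pos hη ha0))) 2
  obtain ⟨i1, e1⟩ := intervalIntegrable_and_integral_eq_of_eqOn_Ioo
    (f := fun θ => (ε θ)⁻¹ * (Φ θ) ^ 2)
    (g := fun θ => εd⁻¹ * (Real.sinh (η * (Real.pi + θ)) / Real.sinh (η * (Real.pi - a))) ^ 2)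
    (a := -Real.pi) (b := -a) (by linarith) (by fun_prop) (by
      intro θ hθ
      have hθ' : θ < 0 := by linarith [hθ.2]
      simp only
      rw [hε2 θ (by rw [abs_of_neg hθ']; linarith [hθ.2]) (by rw [abs_of_neg hθ']; linarith [hθ.1]),
        hΦ3 θ hθ.1.le hθ'.le, hΦ2 (-θ) (by linarith [hθ.2]) (by linarith [hθ.1]), neg_sq,
        sub_neg_eq_add])
  obtain ⟨i2, e2⟩ := intervalIntegrable_and_integral_eq_of_eqOn_Ioo
    (f := fun θ => (ε θ)⁻¹ * (Φ θ) ^ 2)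
    (g := fun θ => εm⁻¹ * (Real.sinh (η * (-θ)) / Real.sinh (η * a)) ^ 2)
    (a := -a) (b := 0) (by linarith) (by fun_prop) (by
      intro θ hθ
      simp only
      rw [hε1 θ (by rw [abs_of_neg hθ.2]; linarith [hθ.1]),
        hΦ3 θ (by linarith [hθ.1]) hθ.2.le, hΦ1 (-θ) (by linarith [hθ.2]) (by linarith [hθ.1]),
        neg_sq])
  obtain ⟨i3, e3⟩ := intervalIntegrable_and_integral_eq_of_eqOn_Ioo
    (f := fun θ => (ε θ)⁻¹ * (Φ θ) ^ 2)
    (g := fun θ => εm⁻¹ * (Real.sinh (η * θ) / Real.sinh (η * a)) ^ 2)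
    (a := 0) (b := a) ha0.le (by fun_prop) (by
      intro θ hθ
      simp only
      rw [hε1 θ (by rw [abs_of_pos hθ.1]; exact hθ.2), hΦ1 θ hθ.1.le hθ.2.le])
  obtain ⟨i4, e4⟩ := intervalIntegrable_and_integral_eq_of_eqOn_Ioo
    (f := fun θ => (ε θ)⁻¹ * (Φ θ) ^ 2)
    (g := fun θ => εd⁻¹ * (Real.sinh (η * (Real.pi - θ)) / Real.sinh (η * (Real.pi - a))) ^ 2)
    (a := a) (b := Real.pi) haπ.le (by fun_prop) (by
      intro θ hθ
      have hθ' : 0 < θ := ha0.trans hθ.1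
      simp only
      rw [hε2 θ (by rw [abs_of_pos hθ']; exact hθ.1) (by rw [abs_of_pos hθ']; exact hθ.2.le),
        hΦ2 θ hθ.1.le hθ.2.le])
  rw [intervalIntegral.integral_const_mul] at e1 e2 e3 e4
  rw [intervalIntegral.integral_comp_add_left
    (fun s => (Real.sinh (η * s) / Real.sinh (η * (Real.pi - a))) ^ 2) Real.pi,
    add_neg_cancel, ← sub_eq_add_neg] at e1
  rw [intervalIntegral.integral_comp_neg
    (fun s => (Real.sinh (η * s) / Real.sinh (η * a)) ^ 2), neg_neg, neg_zero] at e2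
  rw [intervalIntegral.integral_comp_sub_left
    (fun s => (Real.sinh (η * s) / Real.sinh (η * (Real.pi - a))) ^ 2) Real.pi,
    sub_self] at e4
  rw [← intervalIntegral.integral_add_adjacent_intervals ((i1.trans i2).trans i3) i4,
    ← intervalIntegral.integral_add_adjacent_intervals (i1.trans i2) i3,
    ← intervalIntegral.integral_add_adjacent_intervals i1 i2, e1, e2, e3, e4, ← hA, ← hB]
  have hm : -εd⁻¹ < εm⁻¹ := by
    rw [div_lt_iff₀ hεd] at hκ2
    rw [← inv_neg]
    exact (inv_lt_inv_of_neg (neg_lt_zero.2 hεd) hεm).2 (by linarith)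
  have h1 : εd⁻¹ * A ≤ εd⁻¹ * B := mul_le_mul_of_nonneg_left hAB (inv_pos.2 hεd).le
  have h2 : -εd⁻¹ * A < εm⁻¹ * A := mul_lt_mul_of_pos_right hm hA0
  linarith
end

section
/- Let π < φ < 2π, η > 0, and let ε_m < 0 < ε_d be real numbers whose contrast κ = ε_m/ε_d satisfies κ ∈ (−1, −(2π−φ)/φ). Let Φ be the skew-symmetric corner profile and ε the piecewise permittivity. Then ∫_{−π}^{π} ε(θ)^{−1}·Φ(θ)² dθ < 0. -/
open MeasureTheory in
/-- A function agreeing with a continuous one on the open interval is interval integrable,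
with the same integral. -/
theorem integral_eq_of_eqOn_Ioo {f k : ℝ → ℝ} {a b : ℝ} (hab : a ≤ b) (hk : Continuous k)
    (h : ∀ x, a < x → x < b → f x = k x) :
    IntervalIntegrable f volume a b ∧ ∫ x in a..b, f x = ∫ x in a..b, k x := by
  have hE : Set.EqOn f k (Set.Ioo a b) := fun x hx => h x hx.1 hx.2
  refine ⟨?_, ?_⟩
  · rw [intervalIntegrable_iff_integrableOn_Ioo_of_le hab]
    refine IntegrableOn.congr_fun ?_ hE.symm measurableSet_Ioo
    exact (intervalIntegrable_iff_integrableOn_Ioo_of_le hab).1 (hk.intervalIntegrable a b)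
  · rw [intervalIntegral.integral_of_le hab, intervalIntegral.integral_of_le hab,
      integral_Ioc_eq_integral_Ioo, integral_Ioc_eq_integral_Ioo]
    exact setIntegral_congr_fun measurableSet_Ioo hE

/-- The mean-square integral of the normalized hyperbolic sine on `[0, c]` is monotone in `c`. -/
theorem integral_sinh_div_sinh_sq_mono {η a b : ℝ} (hη : 0 < η) (hb : 0 < b) (hba : b ≤ a) :
    ∫ t in (0 : ℝ)..b, (Real.sinh (η * t) / Real.sinh (η * b)) ^ 2 ≤
      ∫ t in (0 : ℝ)..a, (Real.sinh (η * t) / Real.sinh (η * a)) ^ 2 := by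
  have hcont : ∀ c : ℝ, Continuous fun t => (Real.sinh (η * t) / Real.sinh (η * c)) ^ 2 := by
    intro c; fun_prop
  have hsb : 0 < Real.sinh (η * b) := Real.sinh_pos_iff.2 (mul_pos hη hb)
  have hsa : 0 < Real.sinh (η * a) := Real.sinh_pos_iff.2 (mul_pos hη (hb.trans_le hba))
  have hshift : ∫ t in (0 : ℝ)..b, (Real.sinh (η * (t + (a - b))) / Real.sinh (η * a)) ^ 2 =
      ∫ t in (a - b)..a, (Real.sinh (η * t) / Real.sinh (η * a)) ^ 2 := by
    rw [intervalIntegral.integral_comp_add_right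
      (fun t => (Real.sinh (η * t) / Real.sinh (η * a)) ^ 2)]
    simp
  have hsplit := intervalIntegral.integral_add_adjacent_intervals
    ((hcont a).intervalIntegrable (μ := MeasureTheory.volume) 0 (a - b))
    ((hcont a).intervalIntegrable (a - b) a)
  have hnonneg : 0 ≤ ∫ t in (0 : ℝ)..(a - b), (Real.sinh (η * t) / Real.sinh (η * a)) ^ 2 :=
    intervalIntegral.integral_nonneg (by linarith) fun t _ => sq_nonneg _
  have hmono : ∫ t in (0 : ℝ)..b, (Real.sinh (η * t) / Real.sinh (η * b)) ^ 2 ≤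
      ∫ t in (0 : ℝ)..b, (Real.sinh (η * (t + (a - b))) / Real.sinh (η * a)) ^ 2 := by
    refine intervalIntegral.integral_mono_on hb.le ((hcont b).intervalIntegrable _ _)
      (Continuous.intervalIntegrable (by fun_prop) _ _) fun t ht => ?_
    have h0 : 0 ≤ Real.sinh (η * t) := Real.sinh_nonneg_iff.2 (mul_nonneg hη.le ht.1)
    refine pow_le_pow_left₀ (div_nonneg h0 hsb.le) ?_ 2
    rw [div_le_div_iff₀ hsb hsa]
    have hu : 0 ≤ Real.sinh (η * (b - t)) :=
      Real.sinh_nonneg_iff.2 (mul_nonneg hη.le (by linarith [ht.2]))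
    have hd : 0 ≤ Real.sinh (η * (a - b)) :=
      Real.sinh_nonneg_iff.2 (mul_nonneg hη.le (by linarith))
    have key : Real.sinh (η * (t + (a - b))) * Real.sinh (η * b) -
        Real.sinh (η * t) * Real.sinh (η * a) =
        Real.sinh (η * (b - t)) * Real.sinh (η * (a - b)) := by
      have e1 : η * (t + (a - b)) = η * t + η * (a - b) := by ring
      have e2 : η * a = η * b + η * (a - b) := by ring
      have e3 : η * (b - t) = η * b - η * t := by ring
      rw [e1, e2, e3, Real.sinh_add, Real.sinh_add, Real.sinh_sub]
      ring
    nlinarith [mul_nonneg hu hd]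
  linarith


/-- For π < φ < 2π, η > 0, ε_m < 0 < ε_d with contrast κ = ε_m/ε_d ∈ (−1, −(2π−φ)/φ),
the skew-symmetric corner profile Φ and piecewise permittivity ε satisfy
∫_{−π}^{π} ε(θ)⁻¹ Φ(θ)² dθ < 0. -/
theorem stmt_13 (φ η εm εd : ℝ) (hφ0 : Real.pi < φ) (hφπ : φ < 2 * Real.pi) (hη : 0 < η)
    (hεm : εm < 0) (hεd : 0 < εd)
    (hκ1 : -1 < εm / εd) (hκ2 : εm / εd < -((2 * Real.pi - φ) / φ))
    (Φ ε : ℝ → ℝ)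
    (hΦ1 : ∀ θ, 0 ≤ θ → θ ≤ φ / 2 →
      Φ θ = Real.sinh (η * θ) / Real.sinh (η * (φ / 2)))
    (hΦ2 : ∀ θ, φ / 2 ≤ θ → θ ≤ Real.pi →
      Φ θ = Real.sinh (η * (Real.pi - θ)) / Real.sinh (η * (Real.pi - φ / 2)))
    (hΦ3 : ∀ θ, -Real.pi ≤ θ → θ ≤ 0 → Φ θ = -Φ (-θ))
    (hε1 : ∀ θ, |θ| < φ / 2 → ε θ = εm)
    (hε2 : ∀ θ, φ / 2 < |θ| → |θ| ≤ Real.pi → ε θ = εd) :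
    (∫ θ in (-Real.pi)..Real.pi, (ε θ)⁻¹ * (Φ θ)^2) < 0 := by
  obtain ⟨a, ha⟩ : ∃ a, a = φ / 2 := ⟨_, rfl⟩
  rw [← ha] at hΦ1 hΦ2 hε1 hε2
  have hpi := Real.pi_pos
  have ha0 : 0 < a := by linarith
  have hb0 : 0 < Real.pi - a := by linarith
  have hcont : ∀ c : ℝ, Continuous fun t => (Real.sinh (η * t) / Real.sinh (η * c)) ^ 2 := by
    intro c; fun_prop
  obtain ⟨i1, e1⟩ := integral_eq_of_eqOn_Ioo (f := fun θ => (ε θ)⁻¹ * (Φ θ) ^ 2)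
    (k := fun θ => εd⁻¹ * (Real.sinh (η * (Real.pi + θ)) / Real.sinh (η * (Real.pi - a))) ^ 2)
    (a := -Real.pi) (b := -a) (by linarith) (by fun_prop) (by
      intro x h1 h2
      have hx : |x| = -x := abs_of_neg (by linarith)
      rw [hε2 x (by linarith) (by linarith), hΦ3 x h1.le (by linarith),
        hΦ2 (-x) (by linarith) (by linarith), neg_sq, sub_neg_eq_add])
  obtain ⟨i2, e2⟩ := integral_eq_of_eqOn_Ioo (f := fun θ => (ε θ)⁻¹ * (Φ θ) ^ 2)
    (k := fun θ => εm⁻¹ * (Real.sinh (η * (-θ)) / Real.sinh (η * a)) ^ 2)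
    (a := -a) (b := 0) (by linarith) (by fun_prop) (by
      intro x h1 h2
      have hx : |x| = -x := abs_of_neg h2
      rw [hε1 x (by linarith), hΦ3 x (by linarith) h2.le,
        hΦ1 (-x) (by linarith) (by linarith), neg_sq])
  obtain ⟨i3, e3⟩ := integral_eq_of_eqOn_Ioo (f := fun θ => (ε θ)⁻¹ * (Φ θ) ^ 2)
    (k := fun θ => εm⁻¹ * (Real.sinh (η * θ) / Real.sinh (η * a)) ^ 2)
    (a := 0) (b := a) (by linarith) (by fun_prop) (by
      intro x h1 h2
      have hx : |x| = x := abs_of_pos h1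
      rw [hε1 x (by linarith), hΦ1 x h1.le h2.le])
  obtain ⟨i4, e4⟩ := integral_eq_of_eqOn_Ioo (f := fun θ => (ε θ)⁻¹ * (Φ θ) ^ 2)
    (k := fun θ => εd⁻¹ * (Real.sinh (η * (Real.pi - θ)) / Real.sinh (η * (Real.pi - a))) ^ 2)
    (a := a) (b := Real.pi) (by linarith) (by fun_prop) (by
      intro x h1 h2
      have hx : |x| = x := abs_of_pos (by linarith)
      rw [hε2 x (by linarith) (by linarith), hΦ2 x h1.le h2.le])
  rw [intervalIntegral.integral_const_mul] at e1 e2 e3 e4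
  rw [intervalIntegral.integral_comp_add_left
    (fun t => (Real.sinh (η * t) / Real.sinh (η * (Real.pi - a))) ^ 2), add_neg_cancel,
    ← sub_eq_add_neg] at e1
  rw [intervalIntegral.integral_comp_neg
    (fun t => (Real.sinh (η * t) / Real.sinh (η * a)) ^ 2), neg_zero, neg_neg] at e2
  rw [intervalIntegral.integral_comp_sub_left
    (fun t => (Real.sinh (η * t) / Real.sinh (η * (Real.pi - a))) ^ 2), sub_self] at e4
  have hBA := integral_sinh_div_sinh_sq_mono hη hb0 (show Real.pi - a ≤ a by linarith)
  have hB : 0 < ∫ t in (0 : ℝ)..(Real.pi - a),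
      (Real.sinh (η * t) / Real.sinh (η * (Real.pi - a))) ^ 2 :=
    intervalIntegral.intervalIntegral_pos_of_pos_on ((hcont _).intervalIntegrable _ _)
      (fun t ht => pow_pos (div_pos (Real.sinh_pos_iff.2 (mul_pos hη ht.1))
        (Real.sinh_pos_iff.2 (mul_pos hη hb0))) 2) hb0
  rw [← intervalIntegral.integral_add_adjacent_intervals ((i1.trans i2).trans i3) i4,
    ← intervalIntegral.integral_add_adjacent_intervals (i1.trans i2) i3,
    ← intervalIntegral.integral_add_adjacent_intervals i1 i2, e1, e2, e3, e4]
  have hsum : εm⁻¹ + εd⁻¹ < 0 := by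
    have h1 : 0 < εm + εd := by
      rw [lt_div_iff₀ hεd] at hκ1
      linarith
    have h2 : εm⁻¹ + εd⁻¹ = (εm + εd) / (εm * εd) := by
      have h3 := hεm.ne
      have h4 := hεd.ne'
      field_simp
      ring
    rw [h2]
    exact div_neg_of_pos_of_neg h1 (mul_neg_of_neg_of_pos hεm hεd)
  have hm : εm⁻¹ < 0 := inv_lt_zero.2 hεm
  nlinarith [mul_le_mul_of_nonpos_left hBA hm.le, mul_neg_of_neg_of_pos hsum hB]
end

section
/- Let 0 < φ < 2π, η > 0, and let ε_m < 0 < ε_d be real numbers with contrast κ = ε_m/ε_d and b = (2π−φ)/φ. Let Φ be the skew-symmetric corner profile. Then: (i) Φ(0) = 0, Φ(π) = 0, and Φ is continuous at φ/2 with Φ(φ/2) = 1; (ii) on each of the open intervals (0, φ/2) and (φ/2, π), Φ is twice differentiable and satisfies Φ''(θ) = η²·Φ(θ); (iii) the left derivative of Φ at φ/2 equals η·cosh(ηφ/2)/sinh(ηφ/2) and the right derivative of Φ at φ/2 equals −η·cosh(η(π−φ/2))/sinh(η(π−φ/2)); (iv) the transmission condition (1/ε_m)·(left derivative of Φ at φ/2)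 = (1/ε_d)·(right derivative of Φ at φ/2) holds if and only if κ·tanh(ηφ/2) + tanh(b·ηφ/2) = 0, i.e. if and only if f⁺(ηφ/2) = 0. -/
open Filter Topology

theorem hasDerivAt_sinh_affine_div (a b c x : ℝ) :
    HasDerivAt (fun y => Real.sinh (a * y + b) / c) (a * Real.cosh (a * x + b) / c) x := by
  have h : HasDerivAt (fun y : ℝ => a * y + b) a x := by
    simpa using ((hasDerivAt_id x).const_mul a).add_const b
  simpa [mul_comm] using h.sinh.div_const c

theorem hasDerivAt_cosh_affine_div (a b c x : ℝ) :
    HasDerivAt (fun y => a * Real.cosh (a * y + b) / c)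
      (a ^ 2 * (Real.sinh (a * x + b) / c)) x := by
  have h : HasDerivAt (fun y : ℝ => a * y + b) a x := by
    simpa using ((hasDerivAt_id x).const_mul a).add_const b
  exact ((h.cosh.const_mul a).div_const c).congr_deriv (by ring)

/-- A function agreeing near `x` with `y ↦ sinh (a * y + b) / c` solves `f'' = a² f` at `x`. -/
theorem deriv_deriv_eq_of_eventuallyEq_sinh_affine_div {f : ℝ → ℝ} {a b c x : ℝ}
    (h : f =ᶠ[𝓝 x] fun y => Real.sinh (a * y + b) / c) :
    DifferentiableAt ℝ f x ∧ DifferentiableAt ℝ (deriv f) x ∧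
      deriv (deriv f) x = a ^ 2 * f x := by
  have h₁ : deriv f =ᶠ[𝓝 x] fun y => a * Real.cosh (a * y + b) / c :=
    h.deriv.trans (Eventually.of_forall fun y => (hasDerivAt_sinh_affine_div a b c y).deriv)
  have h₂ := (hasDerivAt_cosh_affine_div a b c x).congr_of_eventuallyEq h₁
  refine ⟨((hasDerivAt_sinh_affine_div a b c x).congr_of_eventuallyEq h).differentiableAt,
    h₂.differentiableAt, ?_⟩
  rw [h₂.deriv, h.eq_of_nhds]

/-- The transmission condition for the logarithmic derivatives `η coth A` and `-η coth B`,
in terms of hyperbolic tangents. -/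
theorem transmission_iff_tanh {η p q A B : ℝ} (hη : η ≠ 0) (hp : p ≠ 0) (hq : q ≠ 0)
    (hA : A ≠ 0) (hB : B ≠ 0) :
    (1 / p) * (η * Real.cosh A / Real.sinh A) = (1 / q) * (-(η * Real.cosh B / Real.sinh B)) ↔
      (p / q) * Real.tanh A + Real.tanh B = 0 := by
  have hsA : Real.sinh A ≠ 0 := Real.sinh_ne_zero.mpr hA
  have hsB : Real.sinh B ≠ 0 := Real.sinh_ne_zero.mpr hB
  have hcA : Real.cosh A ≠ 0 := (Real.cosh_pos A).ne'
  have hcB : Real.cosh B ≠ 0 := (Real.cosh_pos B).ne'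
  rw [Real.tanh_eq_sinh_div_cosh, Real.tanh_eq_sinh_div_cosh]
  field_simp
  constructor <;> intro h <;> linarith


/-- Properties of the skew-symmetric corner profile Φ: boundary values and continuity,
the ODE Φ'' = η²Φ on each subinterval, the one-sided derivatives at φ/2, and the
equivalence of the transmission condition with f⁺(ηφ/2) = 0 where
f⁺(t) = κ tanh t + tanh(bt), κ = ε_m/ε_d, b = (2π−φ)/φ. -/
theorem stmt_16 (φ η εm εd : ℝ) (hφ0 : 0 < φ) (hφ2 : φ < 2 * Real.pi) (hη : 0 < η)
    (hεm : εm < 0) (hεd : 0 < εd) (Φ : ℝ → ℝ)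
    (hΦ1 : ∀ θ, 0 ≤ θ → θ ≤ φ / 2 →
      Φ θ = Real.sinh (η * θ) / Real.sinh (η * (φ / 2)))
    (hΦ2 : ∀ θ, φ / 2 ≤ θ → θ ≤ Real.pi →
      Φ θ = Real.sinh (η * (Real.pi - θ)) / Real.sinh (η * (Real.pi - φ / 2)))
    (hΦ3 : ∀ θ, -Real.pi ≤ θ → θ ≤ 0 → Φ θ = -Φ (-θ)) :
    -- (i)
    (Φ 0 = 0 ∧ Φ Real.pi = 0 ∧ ContinuousAt Φ (φ / 2) ∧ Φ (φ / 2) = 1) ∧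
    -- (ii)
    (∀ θ, (θ ∈ Set.Ioo 0 (φ / 2) ∨ θ ∈ Set.Ioo (φ / 2) Real.pi) →
      DifferentiableAt ℝ Φ θ ∧ DifferentiableAt ℝ (deriv Φ) θ ∧
        deriv (deriv Φ) θ = η ^ 2 * Φ θ) ∧
    -- (iii)
    (HasDerivWithinAt Φ
      (η * Real.cosh (η * (φ / 2)) / Real.sinh (η * (φ / 2)))
      (Set.Iic (φ / 2)) (φ / 2) ∧
     HasDerivWithinAt Φ
      (-(η * Real.cosh (η * (Real.pi - φ / 2)) / Real.sinh (η * (Real.pi - φ / 2))))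
      (Set.Ici (φ / 2)) (φ / 2)) ∧
    -- (iv)
    ((1 / εm) * (η * Real.cosh (η * (φ / 2)) / Real.sinh (η * (φ / 2)))
        = (1 / εd) *
          (-(η * Real.cosh (η * (Real.pi - φ / 2)) / Real.sinh (η * (Real.pi - φ / 2))))
      ↔ (εm / εd) * Real.tanh (η * (φ / 2))
          + Real.tanh (((2 * Real.pi - φ) / φ) * (η * (φ / 2))) = 0) := by
  have hη0 : η ≠ 0 := hη.ne'
  have hA : η * (φ / 2) ≠ 0 := by positivity
  have hB : η * (Real.pi - φ / 2) ≠ 0 := mul_ne_zero hη0 (by linarith)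
  have hsA : Real.sinh (η * (φ / 2)) ≠ 0 := Real.sinh_ne_zero.mpr hA
  have hΦ2' : ∀ θ, φ / 2 ≤ θ → θ ≤ Real.pi →
      Φ θ = Real.sinh (-η * θ + η * Real.pi) / Real.sinh (η * (Real.pi - φ / 2)) := by
    intro θ h₁ h₂
    rw [hΦ2 θ h₁ h₂]
    ring_nf
  have hval : Φ (φ / 2) = 1 := by
    rw [hΦ1 _ (by linarith) le_rfl, div_self hsA]
  have hL : HasDerivWithinAt Φ
      (η * Real.cosh (η * (φ / 2)) / Real.sinh (η * (φ / 2))) (Set.Iic (φ / 2)) (φ / 2) := by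
    have h := hasDerivAt_sinh_affine_div η 0 (Real.sinh (η * (φ / 2))) (φ / 2)
    simp only [add_zero] at h
    refine h.hasDerivWithinAt.congr_of_eventuallyEq ?_ (hΦ1 _ (by linarith) le_rfl)
    filter_upwards [self_mem_nhdsWithin,
      mem_nhdsWithin_of_mem_nhds (Ioi_mem_nhds (show 0 < φ / 2 by linarith))] with θ h₁ h₂
    exact hΦ1 θ (le_of_lt h₂) h₁
  have hR : HasDerivWithinAt Φ
      (-(η * Real.cosh (η * (Real.pi - φ / 2)) / Real.sinh (η * (Real.pi - φ / 2))))
      (Set.Ici (φ / 2)) (φ / 2) := by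
    have h := hasDerivAt_sinh_affine_div (-η) (η * Real.pi)
      (Real.sinh (η * (Real.pi - φ / 2))) (φ / 2)
    rw [show -η * (φ / 2) + η * Real.pi = η * (Real.pi - φ / 2) by ring, neg_mul, neg_div] at h
    refine h.hasDerivWithinAt.congr_of_eventuallyEq ?_ (hΦ2' _ le_rfl (by linarith))
    filter_upwards [self_mem_nhdsWithin,
      mem_nhdsWithin_of_mem_nhds (Iio_mem_nhds (show φ / 2 < Real.pi by linarith))] with θ h₁ h₂
    exact hΦ2' θ h₁ (le_of_lt h₂)
  refine ⟨⟨?_, ?_, ?_, hval⟩, ?_, ⟨hL, hR⟩, ?_⟩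
  · simp [hΦ1 0 le_rfl (by linarith)]
  · simp [hΦ2 Real.pi (by linarith) le_rfl]
  · exact continuousAt_iff_continuous_left_right.mpr
      ⟨hL.continuousWithinAt, hR.continuousWithinAt⟩
  · rintro θ (hθ | hθ)
    · refine deriv_deriv_eq_of_eventuallyEq_sinh_affine_div (b := 0)
        (c := Real.sinh (η * (φ / 2))) ?_
      filter_upwards [Ioo_mem_nhds hθ.1 hθ.2] with y hy
      rw [add_zero]
      exact hΦ1 y hy.1.le hy.2.le
    · rw [← neg_sq η]
      refine deriv_deriv_eq_of_eventuallyEq_sinh_affine_div (b := η * Real.pi)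
        (c := Real.sinh (η * (Real.pi - φ / 2))) ?_
      filter_upwards [Ioo_mem_nhds hθ.1 hθ.2] with y hy
      exact hΦ2' y hy.1.le hy.2.le
  · rw [show (2 * Real.pi - φ) / φ * (η * (φ / 2)) = η * (Real.pi - φ / 2) by field_simp]
    exact transmission_iff_tanh hη0 hεm.ne hεd.ne' hA hB
end

section
/- Let 0 < φ < 2π, η > 0, and let ε_m < 0 < ε_d be real numbers with contrast κ = ε_m/ε_d and b = (2π−φ)/φ. Let Φ be the symmetric corner profile. Then: (i) the derivative of Φ vanishes at θ = 0 and at θ = π, and Φ is continuous at φ/2 with Φ(φ/2) = 1; (ii) on each of the open intervals (0, φ/2) and (φ/2, π), Φ is twice differentiable and satisfies Φ''(θ) = η²·Φ(θ); (iii) the left derivative of Φ at φ/2 equals η·sinh(ηφ/2)/cosh(ηφ/2) and the right derivative of Φ at φ/2 equals −η·sinh(η(π−φ/2))/cosh(η(π−φ/2)); (iv) the transmission condition (1/ε_m)·(left derivative of Φ at φ/2) = (1/ε_d)·(right derivative of Φ at φ/2) holds if and only if (1/κ)·tanh(ηφ/2) + tanh(b·ηφ/2) = 0, i.e. if and only if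 f⁻(ηφ/2) = 0. -/
/-- The second derivative at a point only depends on the germ of the function there. -/
theorem differentiableAt_deriv_of_eventuallyEq {f g g' : ℝ → ℝ} {x c : ℝ}
    (hfg : f =ᶠ[nhds x] g) (hg : ∀ y, HasDerivAt g (g' y) y) (hg' : HasDerivAt g' c x) :
    DifferentiableAt ℝ f x ∧ DifferentiableAt ℝ (deriv f) x ∧ deriv (deriv f) x = c := by
  have hd : deriv f =ᶠ[nhds x] g' := by
    have h := hfg.deriv
    rwa [show deriv g = g' from funext fun y => (hg y).deriv] at h
  have h2 : HasDerivAt (deriv f) c x := hg'.congr_of_eventuallyEq hd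
  exact ⟨((hg x).congr_of_eventuallyEq hfg).differentiableAt, h2.differentiableAt, h2.deriv⟩

theorem hasDerivAt_cosh_const_mul_div (a C x : ℝ) :
    HasDerivAt (fun y => Real.cosh (a * y) / C) (a * Real.sinh (a * x) / C) x := by
  refine HasDerivAt.congr_deriv
    ((((hasDerivAt_id' x).const_mul a).cosh).div_const C) ?_
  ring

theorem hasDerivAt_sinh_const_mul_div (a C x : ℝ) :
    HasDerivAt (fun y => a * Real.sinh (a * y) / C) (a ^ 2 * (Real.cosh (a * x) / C)) x := by
  refine HasDerivAt.congr_deriv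
    (((((hasDerivAt_id' x).const_mul a).sinh).const_mul a).div_const C) ?_
  ring

theorem hasDerivAt_cosh_const_mul_sub_div (a p C x : ℝ) :
    HasDerivAt (fun y => Real.cosh (a * (p - y)) / C) (-(a * Real.sinh (a * (p - x)) / C)) x := by
  refine HasDerivAt.congr_deriv
    (((((hasDerivAt_id' x).const_sub p).const_mul a).cosh).div_const C) ?_
  ring

theorem hasDerivAt_sinh_const_mul_sub_div (a p C x : ℝ) :
    HasDerivAt (fun y => -(a * Real.sinh (a * (p - y)) / C))
      (a ^ 2 * (Real.cosh (a * (p - x)) / C)) x := by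
  refine HasDerivAt.congr_deriv
    ((((((hasDerivAt_id' x).const_sub p).const_mul a).sinh.const_mul a).div_const C).neg) ?_
  ring

/-- Properties of the symmetric corner profile Φ: vanishing derivative at 0 and π,
continuity at φ/2, the ODE Φ'' = η²Φ on each subinterval, the one-sided derivatives
at φ/2, and the equivalence of the transmission condition with f⁻(ηφ/2) = 0 where
f⁻(t) = (1/κ) tanh t + tanh(bt), κ = ε_m/ε_d, b = (2π−φ)/φ. -/
theorem stmt_17 (φ η εm εd : ℝ) (hφ0 : 0 < φ) (hφ2 : φ < 2 * Real.pi) (hη : 0 < η)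
    (hεm : εm < 0) (hεd : 0 < εd) (Φ : ℝ → ℝ)
    (hΦ1 : ∀ θ, 0 ≤ θ → θ ≤ φ / 2 →
      Φ θ = Real.cosh (η * θ) / Real.cosh (η * (φ / 2)))
    (hΦ2 : ∀ θ, φ / 2 ≤ θ → θ ≤ Real.pi →
      Φ θ = Real.cosh (η * (Real.pi - θ)) / Real.cosh (η * (Real.pi - φ / 2)))
    (hΦ3 : ∀ θ, -Real.pi ≤ θ → θ ≤ 0 → Φ θ = Φ (-θ)) :
    -- (i)
    (HasDerivAt Φ 0 0 ∧
     HasDerivWithinAt Φ 0 (Set.Icc (-Real.pi) Real.pi) Real.pi ∧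
     ContinuousAt Φ (φ / 2) ∧ Φ (φ / 2) = 1) ∧
    -- (ii)
    (∀ θ, (θ ∈ Set.Ioo 0 (φ / 2) ∨ θ ∈ Set.Ioo (φ / 2) Real.pi) →
      DifferentiableAt ℝ Φ θ ∧ DifferentiableAt ℝ (deriv Φ) θ ∧
        deriv (deriv Φ) θ = η ^ 2 * Φ θ) ∧
    -- (iii)
    (HasDerivWithinAt Φ
      (η * Real.sinh (η * (φ / 2)) / Real.cosh (η * (φ / 2)))
      (Set.Iic (φ / 2)) (φ / 2) ∧
     HasDerivWithinAt Φ
      (-(η * Real.sinh (η * (Real.pi - φ / 2)) / Real.cosh (η * (Real.pi - φ / 2))))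
      (Set.Ici (φ / 2)) (φ / 2)) ∧
    -- (iv)
    ((1 / εm) * (η * Real.sinh (η * (φ / 2)) / Real.cosh (η * (φ / 2)))
        = (1 / εd) *
          (-(η * Real.sinh (η * (Real.pi - φ / 2)) / Real.cosh (η * (Real.pi - φ / 2))))
      ↔ (1 / (εm / εd)) * Real.tanh (η * (φ / 2))
          + Real.tanh (((2 * Real.pi - φ) / φ) * (η * (φ / 2))) = 0) := by
  have hπ : φ / 2 < Real.pi := by linarith
  have h0 : 0 < φ / 2 := by linarith
  have hval : Φ (φ / 2) = 1 := by
    rw [hΦ1 _ h0.le le_rfl, div_self (Real.cosh_pos _).ne']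
  have hleft : HasDerivWithinAt Φ
      (η * Real.sinh (η * (φ / 2)) / Real.cosh (η * (φ / 2)))
      (Set.Iic (φ / 2)) (φ / 2) := by
    refine (hasDerivAt_cosh_const_mul_div η _ (φ / 2)).hasDerivWithinAt.congr_of_eventuallyEq
      ?_ (hΦ1 _ h0.le le_rfl)
    filter_upwards [self_mem_nhdsWithin, mem_nhdsWithin_of_mem_nhds (Ioi_mem_nhds h0)] with y hy hy0
    exact hΦ1 y (le_of_lt hy0) hy
  have hright : HasDerivWithinAt Φ
      (-(η * Real.sinh (η * (Real.pi - φ / 2)) / Real.cosh (η * (Real.pi - φ / 2))))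
      (Set.Ici (φ / 2)) (φ / 2) := by
    refine (hasDerivAt_cosh_const_mul_sub_div η Real.pi _
      (φ / 2)).hasDerivWithinAt.congr_of_eventuallyEq ?_ (hΦ2 _ le_rfl hπ.le)
    filter_upwards [self_mem_nhdsWithin, mem_nhdsWithin_of_mem_nhds (Iio_mem_nhds hπ)] with y hy hy0
    exact hΦ2 y hy (le_of_lt hy0)
  refine ⟨⟨?_, ?_, ?_, hval⟩, ?_, ⟨hleft, hright⟩, ?_⟩
  · have h := hasDerivAt_cosh_const_mul_div η (Real.cosh (η * (φ / 2))) 0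
    simp only [mul_zero, Real.sinh_zero, zero_div] at h
    refine h.congr_of_eventuallyEq ?_
    filter_upwards [Ioo_mem_nhds (neg_lt_zero.mpr h0) h0] with y hy
    rcases le_total 0 y with hy0 | hy0
    · exact hΦ1 y hy0 hy.2.le
    · rw [hΦ3 y (by linarith [hy.1]) hy0, hΦ1 (-y) (by linarith) (by linarith [hy.1]),
        mul_neg, Real.cosh_neg]
  · have h := hasDerivAt_cosh_const_mul_sub_div η Real.pi
      (Real.cosh (η * (Real.pi - φ / 2))) Real.pi
    simp only [sub_self, mul_zero, Real.sinh_zero, zero_div, neg_zero] at h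
    refine h.hasDerivWithinAt.congr_of_eventuallyEq ?_ (hΦ2 _ hπ.le le_rfl)
    filter_upwards [self_mem_nhdsWithin, mem_nhdsWithin_of_mem_nhds (Ioi_mem_nhds hπ)] with y hy hy0
    exact hΦ2 y (le_of_lt hy0) hy.2
  · exact continuousAt_iff_continuous_left_right.2
      ⟨hleft.continuousWithinAt, hright.continuousWithinAt⟩
  · rintro θ (hθ | hθ)
    · rw [hΦ1 θ hθ.1.le hθ.2.le]
      refine differentiableAt_deriv_of_eventuallyEq ?_
        (hasDerivAt_cosh_const_mul_div η (Real.cosh (η * (φ / 2))))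
        (hasDerivAt_sinh_const_mul_div η _ θ)
      filter_upwards [Ioo_mem_nhds hθ.1 hθ.2] with y hy
      exact hΦ1 y hy.1.le hy.2.le
    · rw [hΦ2 θ hθ.1.le hθ.2.le]
      refine differentiableAt_deriv_of_eventuallyEq ?_
        (hasDerivAt_cosh_const_mul_sub_div η Real.pi (Real.cosh (η * (Real.pi - φ / 2))))
        (hasDerivAt_sinh_const_mul_sub_div η Real.pi _ θ)
      filter_upwards [Ioo_mem_nhds hθ.1 hθ.2] with y hy
      exact hΦ2 y hy.1.le hy.2.le
  · have hb : (2 * Real.pi - φ) / φ * (η * (φ / 2)) = η * (Real.pi - φ / 2) := by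
      field_simp
    rw [hb, mul_div_assoc, mul_div_assoc, ← Real.tanh_eq_sinh_div_cosh,
      ← Real.tanh_eq_sinh_div_cosh, ← sub_eq_zero]
    have hfac : 1 / εm * (η * Real.tanh (η * (φ / 2)))
          - 1 / εd * -(η * Real.tanh (η * (Real.pi - φ / 2)))
        = η / εd * (1 / (εm / εd) * Real.tanh (η * (φ / 2))
          + Real.tanh (η * (Real.pi - φ / 2))) := by
      have := hεm.ne
      field_simp
      ring
    rw [hfac, mul_eq_zero, or_iff_right (div_pos hη hεd).ne']
end
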